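/- Let f be a real polynomial in n variables with zero constant coefficient which either has degree 1 or has all coefficients nonnegative. Let p ∈ (0,1), let ξ ∈ Ber(p)ⁿ, and let ℓ ≠ 0. Then Pr(f(ξ) = ℓ) ≤ τ(p), where τ(p) := sup_{m∈ℕ} m·p·(1−p)^{m−1}. -/

import Mathlib

open Filter Real
open scoped BigOperators Classical

/-- Probability of an event under the product Bernoulli(p) measure on `ι → Bool`. -/
noncomputable def bernoulliProb {ι : Type*} [Fintype ι] [DecidableEq ι] (p : ℝ)
    (P : (ι → Bool) → Prop) : ℝ :=
  ∑ ω : ι → Bool, if P ω then (∏ i, if ω i then p else 1 - p) else 0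

/-- `τ(p) = sup_{m ∈ ℕ} m p (1-p)^{m-1}`. -/
noncomputable def tau (p : ℝ) : ℝ := ⨆ m : ℕ, (m : ℝ) * p * (1 - p) ^ (m - 1)

/-- Supermodularity of a real function on a lattice. -/
def IsSupermodular {α : Type*} [Lattice α] (g : α → ℝ) : Prop :=
  ∀ x y, g x + g y ≤ g (x ⊔ y) + g (x ⊓ y)

/-- The indicator vector of a finite set. -/
def boolIndicator {n : ℕ} (s : Finset (Fin n)) : Fin n → Bool := fun j => decide (j ∈ s)

theorem insertNth_bot_true {n : ℕ} (i : Fin (n + 1)) :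
    (i.insertNth true ⊥ : Fin (n + 1) → Bool) = boolIndicator {i} := by
  rw [Fin.insertNth_eq_iff]
  refine ⟨by simp [boolIndicator], ?_⟩
  funext j
  simp [boolIndicator, Fin.removeNth, Fin.succAbove_ne]

theorem insertNth_bot_false {n : ℕ} (i : Fin (n + 1)) :
    (i.insertNth false ⊥ : Fin (n + 1) → Bool) = ⊥ := by
  rw [Fin.insertNth_eq_iff]
  exact ⟨rfl, rfl⟩

theorem IsSupermodular.comp_insertNth {n : ℕ} {g : (Fin (n + 1) → Bool) → ℝ}
    (hg : IsSupermodular g) (i : Fin (n + 1)) (b : Bool) :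
    IsSupermodular fun x : Fin n → Bool => g (i.insertNth b x) := by
  intro x y
  have h := hg (i.insertNth b x) (i.insertNth b y)
  have hsup : (i.insertNth b (x ⊔ y) : Fin (n + 1) → Bool)
      = i.insertNth b x ⊔ i.insertNth b y := by
    rw [Fin.insertNth_eq_iff]
    exact ⟨by simp, by funext j; simp [Fin.removeNth]⟩
  have hinf : (i.insertNth b (x ⊓ y) : Fin (n + 1) → Bool)
      = i.insertNth b x ⊓ i.insertNth b y := by
    rw [Fin.insertNth_eq_iff]
    exact ⟨by simp, by funext j; simp [Fin.removeNth]⟩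
  simpa only [hsup, hinf] using h

theorem IsSupermodular.sub_const {α : Type*} [Lattice α] {g : α → ℝ}
    (hg : IsSupermodular g) (c : ℝ) : IsSupermodular fun x => g x - c := by
  intro x y
  have := hg x y
  dsimp only
  linarith

theorem IsSupermodular.card_mul_le {n : ℕ} {g : (Fin n → Bool) → ℝ}
    (hg : IsSupermodular g) (h0 : g ⊥ = 0) {ℓ : ℝ} (h1 : ∀ i, g (boolIndicator {i}) = ℓ)
    (s : Finset (Fin n)) : s.card * ℓ ≤ g (boolIndicator s) := by
  induction s using Finset.induction_on with
  | empty =>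
    have : boolIndicator (∅ : Finset (Fin n)) = ⊥ := by funext j; simp [boolIndicator]
    simp [this, h0]
  | insert a s ha ih =>
    have hsup : boolIndicator s ⊔ boolIndicator {a} = boolIndicator (insert a s) := by
      funext j
      by_cases hj : j = a <;> simp [boolIndicator, hj]
    have hinf : boolIndicator s ⊓ boolIndicator {a} = ⊥ := by
      funext j
      by_cases hj : j = a <;> simp [boolIndicator, hj, ha]
    have h := hg (boolIndicator s) (boolIndicator {a})
    rw [hsup, hinf, h0, h1] at h
    rw [Finset.card_insert_of_notMem ha]
    push_cast
    linarith

theorem IsSupermodular.eq_singleton {n : ℕ} {g : (Fin n → Bool) → ℝ}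
    (hg : IsSupermodular g) (h0 : g ⊥ = 0) {ℓ : ℝ} (hℓ : 0 < ℓ)
    (h1 : ∀ i, g (boolIndicator {i}) = ℓ) {x : Fin n → Bool} (hx : g x = ℓ) :
    ∃ i, boolIndicator {i} = x := by
  obtain ⟨s, rfl⟩ : ∃ s, boolIndicator s = x :=
    ⟨Finset.univ.filter fun j => x j = true, by funext j; simp [boolIndicator]⟩
  have h := hg.card_mul_le h0 h1 s
  rw [hx] at h
  have hc : (s.card : ℝ) ≤ 1 := by
    by_contra! hc
    nlinarith
  have hc' : s.card ≤ 1 := by exact_mod_cast hc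
  rcases Nat.le_one_iff_eq_zero_or_eq_one.mp hc' with hs | hs
  · rw [Finset.card_eq_zero] at hs
    subst hs
    have : boolIndicator (∅ : Finset (Fin n)) = ⊥ := by funext j; simp [boolIndicator]
    rw [this, h0] at hx
    exact absurd hx hℓ.ne
  · obtain ⟨i, rfl⟩ := Finset.card_eq_one.mp hs
    exact ⟨i, rfl⟩

theorem bernoulliProb_eq_insertNth {n : ℕ} (i : Fin (n + 1)) (p : ℝ)
    (P : (Fin (n + 1) → Bool) → Prop) :
    bernoulliProb p P = p * bernoulliProb p (fun x : Fin n → Bool => P (i.insertNth true x))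
      + (1 - p) * bernoulliProb p (fun x : Fin n → Bool => P (i.insertNth false x)) := by
  unfold bernoulliProb
  rw [← (Fin.insertNthEquiv (fun _ => Bool) i).sum_comp, Fintype.sum_prod_type, Fintype.sum_bool,
    Finset.mul_sum, Finset.mul_sum]
  simp [Fin.prod_univ_succAbove _ i]
  rfl

theorem le_tau {p : ℝ} (hp : 0 < p) (hp1 : p < 1) (m : ℕ) :
    (m : ℝ) * p * (1 - p) ^ (m - 1) ≤ tau p := by
  refine le_ciSup (f := fun m : ℕ => (m : ℝ) * p * (1 - p) ^ (m - 1)) ⟨1, ?_⟩ m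
  rintro _ ⟨k, rfl⟩
  have hq : 0 ≤ 1 - p := by linarith
  have hsum : (k : ℝ) * (1 - p) ^ (k - 1) ≤ ∑ j ∈ Finset.range k, (1 - p) ^ j := by
    have := Finset.card_nsmul_le_sum (Finset.range k) (fun j => (1 - p) ^ j) ((1 - p) ^ (k - 1))
      fun j hj => pow_le_pow_of_le_one hq (by linarith)
        (Nat.le_sub_one_of_lt (Finset.mem_range.mp hj))
    simpa using this
  have hgeom := mul_neg_geom_sum (1 - p) k
  rw [sub_sub_cancel] at hgeom
  calc (k : ℝ) * p * (1 - p) ^ (k - 1) = p * (k * (1 - p) ^ (k - 1)) := by ring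
    _ ≤ p * ∑ j ∈ Finset.range k, (1 - p) ^ j := by gcongr
    _ ≤ 1 := by rw [hgeom]; linarith [pow_nonneg hq k]

theorem bernoulliProb_le_of_singleton {n : ℕ} {p : ℝ} (hp : 0 < p) (hp1 : p < 1)
    {P : (Fin n → Bool) → Prop} (hP : ∀ x, P x → ∃ i, boolIndicator {i} = x) :
    bernoulliProb p P ≤ n * p * (1 - p) ^ (n - 1) := by
  set w : (Fin n → Bool) → ℝ := fun x => ∏ i, if x i then p else 1 - p
  have hw : ∀ x, 0 ≤ w x := fun x => Finset.prod_nonneg fun i _ => by split_ifs <;> linarith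
  have hw1 : ∀ i, w (boolIndicator {i}) = p * (1 - p) ^ (n - 1) := by
    intro i
    cases n with
    | zero => exact i.elim0
    | succ n => simp [w, boolIndicator, Fin.prod_univ_succAbove _ i, Fin.succAbove_ne]
  calc bernoulliProb p P
      ≤ ∑ x ∈ Finset.univ.image fun i : Fin n => boolIndicator {i}, w x := by
        unfold bernoulliProb
        rw [← Finset.sum_filter]
        refine Finset.sum_le_sum_of_subset_of_nonneg (fun x hx => ?_) fun x _ _ => hw x
        simpa using hP x (Finset.mem_filter.mp hx).2
    _ ≤ ∑ i : Fin n, w (boolIndicator {i}) :=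
        Finset.sum_image_le_of_nonneg fun x _ => hw x
    _ = n * p * (1 - p) ^ (n - 1) := by simp [hw1, mul_assoc]

theorem IsSupermodular.bernoulliProb_eq_le_tau {p : ℝ} (hp : 0 < p) (hp1 : p < 1) {n : ℕ}
    {g : (Fin n → Bool) → ℝ} (h0 : g ⊥ = 0) (hg : IsSupermodular g)
    (hg' : Monotone g ∨ IsSupermodular fun x => -g x) {ℓ : ℝ} (hℓ : ℓ ≠ 0) :
    bernoulliProb p (fun x => g x = ℓ) ≤ tau p := by
  induction n generalizing ℓ with
  | zero =>
    refine (bernoulliProb_le_of_singleton hp hp1 fun x hx => ?_).trans (le_tau hp hp1 0)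
    rw [Subsingleton.elim x ⊥, h0] at hx
    exact absurd hx.symm hℓ
  | succ n ih =>
    by_cases h1 : ∀ i, g (boolIndicator {i}) = ℓ
    · refine (bernoulliProb_le_of_singleton hp hp1 fun x hx => ?_).trans (le_tau hp hp1 (n + 1))
      rcases hℓ.lt_or_gt with hneg | hpos
      · rcases hg' with hmono | hg'
        · have := hmono (bot_le : ⊥ ≤ boolIndicator {(0 : Fin (n + 1))})
          rw [h0, h1] at this
          exact absurd this hneg.not_ge
        · exact hg'.eq_singleton (by simp [h0]) (neg_pos.mpr hneg) (fun i => by rw [h1])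
            (by rw [hx])
      · exact hg.eq_singleton h0 hpos h1 hx
    · push Not at h1
      obtain ⟨i, hi⟩ := h1
      have restrict : ∀ b, bernoulliProb p (fun x : Fin n → Bool => g (i.insertNth b x) = ℓ)
          ≤ tau p := by
        intro b
        have hb : ℓ - g (i.insertNth b ⊥) ≠ 0 := by
          cases b
          · rwa [insertNth_bot_false, h0, sub_zero]
          · rw [insertNth_bot_true]
            exact sub_ne_zero.mpr hi.symm
        have h := ih (g := fun x => g (i.insertNth b x) - g (i.insertNth b ⊥)) (sub_self _)
          ((hg.comp_insertNth i b).sub_const _) (hg'.imp (fun hmono x y hxy => ?_) fun hg' => ?_) hb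
        · simpa only [sub_left_inj] using h
        · refine sub_le_sub_right (hmono ?_) _
          rw [Fin.insertNth_le_iff]
          simpa using hxy
        · have := (hg'.comp_insertNth i b).sub_const (-g (i.insertNth b ⊥))
          convert this using 2
          ring
      rw [bernoulliProb_eq_insertNth i]
      have ht := mul_le_mul_of_nonneg_left (restrict true) hp.le
      have hf := mul_le_mul_of_nonneg_left (restrict false) (sub_nonneg.mpr hp1.le)
      linarith

/-- The value of the monomial with exponent `m` at a Boolean point. -/
noncomputable def boolMonomial {n : ℕ} (m : Fin n →₀ ℕ) (x : Fin n → Bool) : ℝ :=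
  if ∀ i, m i ≠ 0 → x i = true then 1 else 0

theorem eval_bool_eq_sum {n : ℕ} (f : MvPolynomial (Fin n) ℝ) (x : Fin n → Bool) :
    MvPolynomial.eval (fun i => if x i then (1 : ℝ) else 0) f
      = ∑ m ∈ f.support, f.coeff m * boolMonomial m x := by
  rw [MvPolynomial.eval_eq']
  refine Finset.sum_congr rfl fun m _ => ?_
  congr 1
  unfold boolMonomial
  split_ifs with h
  · refine Finset.prod_eq_one fun i _ => ?_
    by_cases hi : m i = 0
    · simp [hi]
    · simp [h i hi]
  · push Not at h
    obtain ⟨i, hi, hx⟩ := h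
    exact Finset.prod_eq_zero (Finset.mem_univ i) (by simp [hx, hi])

theorem monotone_boolMonomial {n : ℕ} (m : Fin n →₀ ℕ) : Monotone (boolMonomial m) := by
  intro x y hxy
  unfold boolMonomial
  split_ifs with hx hy hy <;> norm_num
  exact hy fun i hi => Bool.eq_true_of_true_le (by simpa [hx i hi] using hxy i)

theorem isSupermodular_boolMonomial {n : ℕ} (m : Fin n →₀ ℕ) :
    IsSupermodular (boolMonomial m) := by
  intro x y
  by_cases hx : ∀ i, m i ≠ 0 → x i = true
  · by_cases hy : ∀ i, m i ≠ 0 → y i = true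
    · have hsup : ∀ i, m i ≠ 0 → (x ⊔ y) i = true := fun i hi => by simp [hx i hi]
      have hinf : ∀ i, m i ≠ 0 → (x ⊓ y) i = true := fun i hi => by simp [hx i hi, hy i hi]
      simp only [boolMonomial, if_pos hx, if_pos hy, if_pos hsup, if_pos hinf, le_refl]
    · have hle := monotone_boolMonomial m (le_sup_left : x ≤ x ⊔ y)
      have hnn : 0 ≤ boolMonomial m (x ⊓ y) := by unfold boolMonomial; positivity
      have hy0 : boolMonomial m y = 0 := if_neg hy
      linarith
  · have hle := monotone_boolMonomial m (le_sup_right : y ≤ x ⊔ y)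
    have hnn : 0 ≤ boolMonomial m (x ⊓ y) := by unfold boolMonomial; positivity
    have hx0 : boolMonomial m x = 0 := if_neg hx
    linarith

theorem boolMonomial_modular {n : ℕ} {m : Fin n →₀ ℕ} (hm : m.degree ≤ 1)
    (x y : Fin n → Bool) :
    boolMonomial m x + boolMonomial m y = boolMonomial m (x ⊔ y) + boolMonomial m (x ⊓ y) := by
  rcases Nat.le_one_iff_eq_zero_or_eq_one.mp hm with h | h
  · rw [Finsupp.degree_eq_zero_iff] at h
    simp [boolMonomial, h]
  · obtain ⟨i, rfl⟩ := (Finsupp.range_single_one (σ := Fin n)).ge h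
    have hval : ∀ z : Fin n → Bool,
        boolMonomial (Finsupp.single i 1) z = if z i = true then 1 else 0 := by
      intro z
      simp [boolMonomial, Finsupp.single_apply]
    simp only [hval, Pi.sup_apply, Pi.inf_apply]
    by_cases hx : x i = true <;> by_cases hy : y i = true <;> simp [hx, hy]

/-- Lemma 3.4: let `f` be an `n`-variable real polynomial with zero constant
coefficient which either has degree at most 1 or has all coefficients nonnegative.
For `p ∈ (0,1)`, `ξ ∈ Ber(p)ⁿ` and `ℓ ≠ 0`, `Pr(f(ξ) = ℓ) ≤ τ(p)`. -/
theorem key_induction (n : ℕ) (f : MvPolynomial (Fin n) ℝ)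
    (h0 : f.coeff 0 = 0)
    (hf : f.totalDegree ≤ 1 ∨ ∀ m, 0 ≤ f.coeff m)
    (p : ℝ) (hp : 0 < p) (hp1 : p < 1) (ℓ : ℝ) (hℓ : ℓ ≠ 0) :
    bernoulliProb p (fun ω : Fin n → Bool =>
        MvPolynomial.eval (fun i => if ω i then (1:ℝ) else 0) f = ℓ)
      ≤ tau p := by
  simp only [eval_bool_eq_sum]
  have hbot : ∑ m ∈ f.support, f.coeff m * boolMonomial m ⊥ = 0 := by
    refine Finset.sum_eq_zero fun m _ => ?_
    by_cases hm : m = 0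
    · rw [hm, h0, zero_mul]
    · obtain ⟨i, hi⟩ := Finsupp.ne_iff.mp hm
      have : boolMonomial m ⊥ = 0 := if_neg fun h => by simpa using h i hi
      rw [this, mul_zero]
  rcases hf with hdeg | hnn
  · have hmod : ∀ x y : Fin n → Bool,
        (∑ m ∈ f.support, f.coeff m * boolMonomial m x)
          + ∑ m ∈ f.support, f.coeff m * boolMonomial m y
        = (∑ m ∈ f.support, f.coeff m * boolMonomial m (x ⊔ y))
          + ∑ m ∈ f.support, f.coeff m * boolMonomial m (x ⊓ y) := by
      intro x y
      simp only [← Finset.sum_add_distrib, ← mul_add]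
      refine Finset.sum_congr rfl fun m hm => ?_
      rw [boolMonomial_modular ((MvPolynomial.le_totalDegree hm).trans hdeg)]
    refine IsSupermodular.bernoulliProb_eq_le_tau hp hp1 hbot (fun x y => (hmod x y).le)
      (Or.inr fun x y => ?_) hℓ
    have := hmod x y
    dsimp only
    linarith
  · have hmono : Monotone fun x : Fin n → Bool =>
        ∑ m ∈ f.support, f.coeff m * boolMonomial m x := fun x y hxy =>
      Finset.sum_le_sum fun m _ =>
        mul_le_mul_of_nonneg_left (monotone_boolMonomial m hxy) (hnn m)
    refine IsSupermodular.bernoulliProb_eq_le_tau hp hp1 hbot (fun x y => ?_) (Or.inl hmono) hℓ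
    simp only [← Finset.sum_add_distrib, ← mul_add]
    exact Finset.sum_le_sum fun m _ =>
      mul_le_mul_of_nonneg_left (isSupermodular_boolMonomial m x y) (hnn m)
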